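/- Let A be a finite quantum group with Haar state h and let φ be a linear functional on A. Then φ is an idempotent state if and only if there exists a group-like projection p ∈ A such that φ(a) = h(p a p)/h(p) for all a ∈ A (note h(p) > 0 for any nonzero projection p by faithfulness and positivity of h). -/

import Mathlib

open TensorProduct HopfAlgebra
open scoped ComplexOrder

noncomputable section

variable {A : Type*} [Ring A] [StarRing A] [HopfAlgebra ℂ A]
  [StarModule ℂ A] [FiniteDimensional ℂ A]

/-- Convolution of linear functionals on a coalgebra: `φ ⋆ ψ := (φ ⊗ ψ) ∘ Δ`. -/
def conv (φ ψ : A →ₗ[ℂ] ℂ) : A →ₗ[ℂ] ℂ :=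
  LinearMap.mul' ℂ ℂ ∘ₗ TensorProduct.map φ ψ ∘ₗ Coalgebra.comul

/-- A state: a unital positive linear functional. -/
def IsState (φ : A →ₗ[ℂ] ℂ) : Prop :=
  φ 1 = 1 ∧ ∀ a : A, 0 ≤ φ (star a * a)

/-- An idempotent state: a state satisfying `φ ⋆ φ = φ`. -/
def IsIdempotentState (φ : A →ₗ[ℂ] ℂ) : Prop :=
  IsState φ ∧ conv φ φ = φ

/-- The Haar state axioms: a faithful state which is a trace and two-sided invariant,
`(h ⊗ id)(Δ a) = h(a)·1 = (id ⊗ h)(Δ a)`. -/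
structure IsHaarState (h : A →ₗ[ℂ] ℂ) : Prop where
  state : IsState h
  faithful : ∀ a : A, h (star a * a) = 0 → a = 0
  left_inv : ∀ a : A,
    TensorProduct.lid ℂ A (TensorProduct.map h LinearMap.id (Coalgebra.comul a)) = h a • 1
  right_inv : ∀ a : A,
    TensorProduct.rid ℂ A (TensorProduct.map LinearMap.id h (Coalgebra.comul a)) = h a • 1
  trace : ∀ a b : A, h (a * b) = h (b * a)

/-- The star-compatibility axioms of a finite quantum group (finite-dimensional Hopf
`*`-algebra): the comultiplication is `*`-preserving (with respect to the entrywise star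
`tstar` on `A ⊗ A`, given as data), and the antipode is `*`-preserving and involutive. -/
structure StarAxioms (tstar : A ⊗[ℂ] A →+ A ⊗[ℂ] A) : Prop where
  tstar_tmul : ∀ a b : A, tstar (a ⊗ₜ[ℂ] b) = star a ⊗ₜ[ℂ] star b
  comul_star : ∀ a : A, Coalgebra.comul (R := ℂ) (star a) = tstar (Coalgebra.comul a)
  antipode_star : ∀ a : A, antipode (R := ℂ) (star a) = star (antipode (R := ℂ) a)
  antipode_invol : ∀ a : A, antipode (R := ℂ) (antipode (R := ℂ) a) = a

/-- A group-like projection: a nonzero self-adjoint idempotent `p` with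
`Δ(p)(1 ⊗ p) = p ⊗ p`. -/
def IsGroupLikeProjection (p : A) : Prop :=
  p ≠ 0 ∧ star p = p ∧ p * p = p ∧
    Coalgebra.comul (R := ℂ) p * ((1 : A) ⊗ₜ[ℂ] p) = p ⊗ₜ[ℂ] p

/-- The functional `φ ⊗ ψ` on `A ⊗ A`. -/
def tensorFunctional (φ ψ : A →ₗ[ℂ] ℂ) : A ⊗[ℂ] A →ₗ[ℂ] ℂ :=
  LinearMap.mul' ℂ ℂ ∘ₗ TensorProduct.map φ ψ

omit [StarRing A] [StarModule ℂ A] [FiniteDimensional ℂ A] in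
@[simp]
lemma tensorFunctional_tmul (φ ψ : A →ₗ[ℂ] ℂ) (a b : A) :
    tensorFunctional φ ψ (a ⊗ₜ b) = φ a * ψ b := by
  simp [tensorFunctional]

omit [StarRing A] [StarModule ℂ A] [FiniteDimensional ℂ A] in
lemma conv_apply (φ ψ : A →ₗ[ℂ] ℂ) (a : A) :
    conv φ ψ a = tensorFunctional φ ψ (Coalgebra.comul a) := rfl

omit [StarRing A] [StarModule ℂ A] [FiniteDimensional ℂ A] in
lemma tensorFunctional_eq_apply_lid (φ ψ : A →ₗ[ℂ] ℂ) (x : A ⊗[ℂ] A) :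
    tensorFunctional φ ψ x = ψ (TensorProduct.lid ℂ A (TensorProduct.map φ LinearMap.id x)) := by
  induction x with
  | zero => simp
  | tmul a b => simp
  | add x y hx hy => simp only [map_add, hx, hy]

omit [StarModule ℂ A] [FiniteDimensional ℂ A] in
lemma IsHaarState.tensorFunctional_comul {h : A →ₗ[ℂ] ℂ} (hh : IsHaarState h) (ψ : A →ₗ[ℂ] ℂ)
    (a : A) : tensorFunctional h ψ (Coalgebra.comul a) = h a * ψ 1 := by
  rw [tensorFunctional_eq_apply_lid, hh.left_inv, map_smul, smul_eq_mul]

omit [FiniteDimensional ℂ A] in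
/-- A positive functional is hermitian. -/
lemma map_star_of_nonneg {φ : A →ₗ[ℂ] ℂ} (hφ : ∀ a : A, 0 ≤ φ (star a * a)) (a : A) :
    φ (star a) = star (φ a) := by
  have im_zero (c : A) : (φ (star c * c)).im = 0 := (Complex.nonneg_iff.1 (hφ c)).2.symm
  have h0 := im_zero a
  have h1 := im_zero (1 : A)
  have h2 := im_zero (a + 1)
  have h3 := im_zero (a + Complex.I • 1)
  simp only [star_add, star_one, star_smul, mul_add, add_mul, mul_one, one_mul, smul_mul_assoc,
    mul_smul_comm, map_add, map_smul, smul_eq_mul, Complex.add_im, Complex.mul_im, Complex.I_re,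
    Complex.I_im, Complex.mul_re, RCLike.star_def, Complex.conj_I, Complex.neg_im,
    Complex.neg_re] at h0 h1 h2 h3
  apply Complex.ext
  · simp only [RCLike.star_def, Complex.conj_re]
    linarith
  · simp only [RCLike.star_def, Complex.conj_im]
    linarith

/-- The semi-inner product `⟪a, b⟫ = φ (a* b)` of a positive functional. -/
abbrev preInnerProductCore (φ : A →ₗ[ℂ] ℂ) (hφ : ∀ a : A, 0 ≤ φ (star a * a)) :
    PreInnerProductSpace.Core ℂ A where
  inner a b := φ (star a * b)
  conj_inner_symm a b := by
    rw [← RCLike.star_def, ← map_star_of_nonneg hφ, star_mul, star_star]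
  re_inner_nonneg a := (Complex.nonneg_iff.1 (hφ a)).1
  add_left a b c := by rw [star_add, add_mul, map_add]
  smul_left a b r := by
    rw [star_smul, smul_mul_assoc, map_smul, smul_eq_mul, RCLike.star_def]

omit [FiniteDimensional ℂ A] in
/-- The Cauchy-Schwarz inequality in the degenerate case. -/
lemma map_mul_eq_zero_of_map_star_mul_self {φ : A →ₗ[ℂ] ℂ} (hφ : ∀ a : A, 0 ≤ φ (star a * a))
    {y : A} (hy : φ (star y * y) = 0) (z : A) : φ (z * y) = 0 := by
  let _ := preInnerProductCore φ hφ
  have key := InnerProductSpace.Core.inner_mul_inner_self_le (𝕜 := ℂ) (star z) y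
  change ‖φ (star (star z) * y)‖ * ‖φ (star y * star z)‖ ≤
    (φ (star (star z) * star z)).re * (φ (star y * y)).re at key
  have hconj : φ (star y * star z) = star (φ (z * y)) := by
    rw [← map_star_of_nonneg hφ, star_mul]
  rw [hy, hconj, star_star, norm_star, Complex.zero_re, mul_zero] at key
  exact norm_eq_zero.1 (mul_self_eq_zero.1 (le_antisymm key (mul_self_nonneg _)))

lemma IsHaarState.exists_orthonormal_basis {h : A →ₗ[ℂ] ℂ} (hh : IsHaarState h) :
    ∃ (n : ℕ) (e : Module.Basis (Fin n) ℂ A),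
      ∀ i j, h (star (e i) * e j) = if i = j then 1 else 0 := by
  let core : InnerProductSpace.Core ℂ A :=
    { preInnerProductCore h hh.state.2 with definite := hh.faithful }
  let _ : NormedAddCommGroup A := core.toNormedAddCommGroup
  let _ : InnerProductSpace ℂ A := InnerProductSpace.ofCore core.toCore
  let e := stdOrthonormalBasis ℂ A
  refine ⟨_, e.toBasis, fun i j => ?_⟩
  rw [e.coe_toBasis]
  exact orthonormal_iff_ite.1 e.orthonormal i j

omit [StarRing A] [StarModule ℂ A] [FiniteDimensional ℂ A] in
lemma exists_eq_sum_basis_tmul {ι : Type*} [Fintype ι] (e : Module.Basis ι ℂ A)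
    (x : A ⊗[ℂ] A) : ∃ y : ι → A, x = ∑ i, e i ⊗ₜ[ℂ] y i := by
  induction x with
  | zero => exact ⟨0, by simp⟩
  | tmul a b =>
    refine ⟨fun i => e.repr a i • b, ?_⟩
    conv_lhs => rw [← e.sum_repr a, TensorProduct.sum_tmul]
    simp only [TensorProduct.smul_tmul]
  | add x y hx hy =>
    obtain ⟨u, rfl⟩ := hx
    obtain ⟨v, rfl⟩ := hy
    exact ⟨u + v, by simp [TensorProduct.tmul_add, Finset.sum_add_distrib]⟩

/-- If `φ = h (b ·)` is positive and `(h ⊗ φ)(x* x) = 0`, then `x (1 ⊗ b) = 0`. -/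
lemma IsHaarState.mul_one_tmul_eq_zero {h : A →ₗ[ℂ] ℂ} (hh : IsHaarState h)
    {tstar : A ⊗[ℂ] A →+ A ⊗[ℂ] A} (hstar : StarAxioms tstar)
    {φ : A →ₗ[ℂ] ℂ} (hφ : ∀ a : A, 0 ≤ φ (star a * a)) {b : A} (hb : ∀ a, φ a = h (b * a))
    {x : A ⊗[ℂ] A} (hx : tensorFunctional h φ (tstar x * x) = 0) :
    x * ((1 : A) ⊗ₜ[ℂ] b) = 0 := by
  obtain ⟨n, e, he⟩ := hh.exists_orthonormal_basis
  obtain ⟨y, rfl⟩ := exists_eq_sum_basis_tmul e x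
  have hsum : ∑ i, φ (star (y i) * y i) = 0 := by
    simpa [hstar.tstar_tmul, Finset.sum_mul_sum, he] using hx
  have hzero := (Finset.sum_eq_zero_iff_of_nonneg fun i _ => hφ (y i)).1 hsum
  rw [Finset.sum_mul]
  refine Finset.sum_eq_zero fun i hi => ?_
  have hyb : y i * b = 0 := by
    refine hh.faithful _ ?_
    rw [← mul_assoc, hh.trace, ← hb]
    exact map_mul_eq_zero_of_map_star_mul_self hφ (hzero i hi) _
  rw [Algebra.TensorProduct.tmul_mul_tmul, hyb, TensorProduct.tmul_zero]

omit [StarModule ℂ A] in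
/-- Every functional has a density with respect to the Haar state. -/
lemma IsHaarState.exists_density {h : A →ₗ[ℂ] ℂ} (hh : IsHaarState h) (φ : A →ₗ[ℂ] ℂ) :
    ∃ b : A, ∀ a, φ a = h (b * a) := by
  let F : A →ₗ[ℂ] Module.Dual ℂ A := (LinearMap.mul ℂ A).compr₂ h
  have hF : Function.Injective F := by
    refine (injective_iff_map_eq_zero F).2 fun b hb => hh.faithful b ?_
    rw [hh.trace]
    exact LinearMap.congr_fun hb (star b)
  have hsurj := (LinearMap.injective_iff_surjective_of_finrank_eq_finrank
    (Subspace.dual_finrank_eq (K := ℂ) (V := A)).symm).1 hF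
  obtain ⟨b, hb⟩ := hsurj φ
  exact ⟨b, fun a => (LinearMap.congr_fun hb a).symm⟩

omit [FiniteDimensional ℂ A] in
lemma IsHaarState.star_density {h : A →ₗ[ℂ] ℂ} (hh : IsHaarState h) {φ : A →ₗ[ℂ] ℂ}
    (hφ : ∀ a : A, 0 ≤ φ (star a * a)) {b : A} (hb : ∀ a, φ a = h (b * a)) : star b = b := by
  have key (a : A) : h (star b * a) = h (b * a) := by
    have h1 : star b * a = star (star a * b) := by rw [star_mul, star_star]
    rw [h1, map_star_of_nonneg hh.state.2, hh.trace, ← hb, map_star_of_nonneg hφ, star_star, hb]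
  refine sub_eq_zero.1 (hh.faithful _ ?_)
  rw [hh.trace, sub_mul, map_sub, key, sub_self]

/-- The density `b` of an idempotent state satisfies `Δ(b)(1 ⊗ b) = b ⊗ b`. -/
lemma IsIdempotentState.comul_density_mul {h : A →ₗ[ℂ] ℂ} (hh : IsHaarState h)
    {tstar : A ⊗[ℂ] A →+ A ⊗[ℂ] A} (hstar : StarAxioms tstar)
    {φ : A →ₗ[ℂ] ℂ} (hφ : IsIdempotentState φ) {b : A} (hb : ∀ a, φ a = h (b * a)) :
    Coalgebra.comul (R := ℂ) b * ((1 : A) ⊗ₜ[ℂ] b) = b ⊗ₜ[ℂ] b := by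
  have hbs := hh.star_density hφ.1.2 hb
  have hleft (x : A ⊗[ℂ] A) :
      tensorFunctional h φ ((b ⊗ₜ[ℂ] (1 : A)) * x) = tensorFunctional φ φ x := by
    induction x with
    | zero => simp
    | tmul u v => simp [hb u]
    | add x y hx hy => simp only [mul_add, map_add, hx, hy]
  have hright (x : A ⊗[ℂ] A) :
      tensorFunctional h φ (x * (b ⊗ₜ[ℂ] (1 : A))) = tensorFunctional φ φ x := by
    induction x with
    | zero => simp
    | tmul u v => simp [hb u, hh.trace u b]
    | add x y hx hy => simp only [add_mul, map_add, hx, hy]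
  have hconv : tensorFunctional φ φ (Coalgebra.comul b) = h (b * b) := by
    rw [← conv_apply, hφ.2, hb]
  have hzero : (Coalgebra.comul (R := ℂ) b - b ⊗ₜ[ℂ] (1 : A)) * ((1 : A) ⊗ₜ[ℂ] b) = 0 := by
    refine hh.mul_one_tmul_eq_zero hstar hφ.1.2 hb ?_
    rw [map_sub, ← hstar.comul_star, hstar.tstar_tmul, hbs, star_one, mul_sub, sub_mul, sub_mul,
      ← Bialgebra.comul_mul, map_sub, map_sub, map_sub, hleft, hright, hconv,
      hh.tensorFunctional_comul, hφ.1.1, Algebra.TensorProduct.tmul_mul_tmul,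
      tensorFunctional_tmul, one_mul, hφ.1.1]
    ring
  rwa [sub_mul, sub_eq_zero, Algebra.TensorProduct.tmul_mul_tmul, mul_one, one_mul] at hzero

omit [StarRing A] [StarModule ℂ A] [FiniteDimensional ℂ A] in
lemma mul_self_eq_counit_smul {b : A}
    (hb : Coalgebra.comul (R := ℂ) b * ((1 : A) ⊗ₜ[ℂ] b) = b ⊗ₜ[ℂ] b) :
    b * b = Coalgebra.counit (R := ℂ) b • b := by
  have hmul (x : A ⊗[ℂ] A) :
      TensorProduct.lid ℂ A (Coalgebra.counit.rTensor A (x * ((1 : A) ⊗ₜ[ℂ] b))) =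
        TensorProduct.lid ℂ A (Coalgebra.counit.rTensor A x) * b := by
    induction x with
    | zero => simp
    | tmul u v => simp
    | add x y hx hy => simp only [add_mul, map_add, hx, hy]
  have key := hmul (Coalgebra.comul b)
  rw [hb, Coalgebra.rTensor_counit_comul] at key
  simpa using key.symm

lemma IsIdempotentState.exists_groupLikeProjection {h : A →ₗ[ℂ] ℂ} (hh : IsHaarState h)
    {tstar : A ⊗[ℂ] A →+ A ⊗[ℂ] A} (hstar : StarAxioms tstar)
    {φ : A →ₗ[ℂ] ℂ} (hφ : IsIdempotentState φ) :
    ∃ p : A, IsGroupLikeProjection p ∧ ∀ a : A, φ a = h (p * a * p) / h p := by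
  obtain ⟨b, hb⟩ := hh.exists_density φ
  have hbs := hh.star_density hφ.1.2 hb
  have hΔ := hφ.comul_density_mul hh hstar hb
  have hsq := mul_self_eq_counit_smul hΔ
  have hb1 : h b = 1 := by simpa [hφ.1.1] using (hb 1).symm
  set c : ℂ := Coalgebra.counit (R := ℂ) b
  have hc : h (b * b) = c := by rw [hsq, map_smul, hb1, smul_eq_mul, mul_one]
  have hb0 : b ≠ 0 := by
    rintro rfl
    simp at hb1
  have hc0 : c ≠ 0 := fun h0 => hb0 (hh.faithful b (by rw [hbs, hc, h0]))
  have hcs : star c = c := by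
    rw [← hc, ← map_star_of_nonneg hh.state.2, star_mul, hbs]
  have hp : (c⁻¹ • b) * (c⁻¹ • b) = c⁻¹ • b := by
    rw [smul_mul_smul_comm, hsq, smul_smul, mul_assoc, inv_mul_cancel₀ hc0, mul_one]
  refine ⟨c⁻¹ • b, ⟨smul_ne_zero (inv_ne_zero hc0) hb0, ?_, hp, ?_⟩, fun a => ?_⟩
  · rw [star_smul, star_inv₀, hcs, hbs]
  · rw [map_smul, TensorProduct.tmul_smul, smul_mul_smul_comm, hΔ, TensorProduct.smul_tmul_smul]
  · rw [hh.trace, ← mul_assoc, hp, smul_mul_assoc, map_smul, map_smul, hb1, ← hb]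
    simp only [smul_eq_mul, mul_one]
    field_simp

omit [StarModule ℂ A] [FiniteDimensional ℂ A] in
lemma IsGroupLikeProjection.isIdempotentState {h : A →ₗ[ℂ] ℂ} (hh : IsHaarState h)
    {p : A} (hp : IsGroupLikeProjection p) {φ : A →ₗ[ℂ] ℂ}
    (hφ : ∀ a : A, φ a = h (p * a * p) / h p) : IsIdempotentState φ := by
  obtain ⟨hp0, hps, hpp, hΔ⟩ := hp
  have hp_nonneg : 0 ≤ h p := by simpa [hps, hpp] using hh.state.2 p
  have hhp : h p ≠ 0 := fun h0 => hp0 (hh.faithful p (by rw [hps, hpp, h0]))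
  have hφ' (a : A) : φ a = h (a * p) / h p := by
    rw [hφ, mul_assoc, hh.trace, mul_assoc, hpp]
  refine ⟨⟨?_, fun a => ?_⟩, ?_⟩
  · rw [hφ', one_mul, div_self hhp]
  · have hstar_mul : p * (star a * a) * p = star (a * p) * (a * p) := by
      rw [star_mul, hps]
      simp only [mul_assoc]
    rw [hφ, hstar_mul]
    exact div_nonneg (hh.state.2 _) hp_nonneg
  · ext a
    have hpull (x : A ⊗[ℂ] A) :
        tensorFunctional φ φ x = tensorFunctional h h (x * (p ⊗ₜ[ℂ] p)) / (h p * h p) := by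
      induction x with
      | zero => simp
      | tmul u v => simp [hφ', div_mul_div_comm]
      | add x y hx hy => simp only [add_mul, map_add, hx, hy, add_div]
    have hright (x : A ⊗[ℂ] A) : tensorFunctional h h (x * ((1 : A) ⊗ₜ[ℂ] p)) =
        tensorFunctional h (h ∘ₗ LinearMap.mulRight ℂ p) x := by
      induction x with
      | zero => simp
      | tmul u v => simp
      | add x y hx hy => simp only [add_mul, map_add, hx, hy]
    rw [conv_apply, hpull, ← hΔ, ← mul_assoc, ← Bialgebra.comul_mul, hright,
      hh.tensorFunctional_comul, hφ']
    simp only [LinearMap.comp_apply, LinearMap.mulRight_apply, one_mul]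
    rw [mul_div_mul_right _ _ hhp]

/-- A linear functional on a finite quantum group is an idempotent state if and only if it
is of the form `a ↦ h(p a p)/h(p)` for a group-like projection `p`. -/
theorem isIdempotentState_iff_exists_groupLikeProjection
    (h : A →ₗ[ℂ] ℂ) (hh : IsHaarState h)
    (tstar : A ⊗[ℂ] A →+ A ⊗[ℂ] A) (hstar : StarAxioms tstar)
    (φ : A →ₗ[ℂ] ℂ) :
    IsIdempotentState φ ↔
      ∃ p : A, IsGroupLikeProjection p ∧ ∀ a : A, φ a = h (p * a * p) / h p := by
  exact ⟨fun hφ => hφ.exists_groupLikeProjection hh hstar,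
    fun ⟨_, hp, hφ⟩ => hp.isIdempotentState hh hφ⟩
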